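/- arXiv:2102.10154 — 11 statements merged into one kernel-verified Lean document; each statement's English description precedes it below -/
import Mathlib

section
/- For fixed thresholds 0 ≤ d < u, the truncated mean function μ_MTuM(θ) := (e^{-d/θ}(d+θ) − e^{-u/θ}(u+θ)) / (e^{-d/θ} − e^{-u/θ}) is strictly increasing in θ on (0, ∞). -/
open Real Set

lemma key_ineq (x : ℝ) (hx : 0 < x) : x ^ 2 * Real.exp x < (Real.exp x - 1) ^ 2 := by
  have h := Real.self_lt_sinh_iff.2 (half_pos hx)
  rw [Real.sinh_eq] at h
  have hp := Real.exp_pos (x / 2)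
  have h1 : Real.exp (x / 2) * Real.exp (-(x / 2)) = 1 := by
    rw [← Real.exp_add]; simp
  have h2 : Real.exp x = Real.exp (x / 2) * Real.exp (x / 2) := by
    rw [← Real.exp_add]; congr 1; ring
  have h3 : x * Real.exp (x / 2) < Real.exp x - 1 := by
    rw [h2]; nlinarith
  have h4 : (x * Real.exp (x / 2)) ^ 2 < (Real.exp x - 1) ^ 2 :=
    pow_lt_pow_left₀ h3 (by positivity) (by norm_num)
  calc x ^ 2 * Real.exp x = (x * Real.exp (x / 2)) ^ 2 := by rw [h2]; ring
    _ < _ := h4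

lemma aux_mono (w : ℝ) (hw : 0 < w) :
    StrictMonoOn (fun t : ℝ => t - w / (Real.exp (w / t) - 1)) (Set.Ioi 0) := by
  have hder : ∀ t : ℝ, 0 < t → HasDerivAt (fun t : ℝ => t - w / (Real.exp (w / t) - 1))
      (1 - (w / t) ^ 2 * Real.exp (w / t) / (Real.exp (w / t) - 1) ^ 2) t := by
    intro t ht
    have hE : Real.exp (w / t) - 1 ≠ 0 := by
      have := Real.one_lt_exp_iff.2 (div_pos hw ht)
      linarith
    have h1 : HasDerivAt (fun t : ℝ => w / t) ((0 * t - w * 1) / t ^ 2) t :=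
      (hasDerivAt_const t w).div (hasDerivAt_id t) ht.ne'
    have h2 := (hasDerivAt_id t).sub ((hasDerivAt_const t w).div (h1.exp.sub_const 1) hE)
    refine h2.congr_deriv ?_
    field_simp
    ring
  refine strictMonoOn_of_deriv_pos (convex_Ioi 0)
    (fun t ht => (hder t ht).continuousAt.continuousWithinAt) ?_
  intro t ht
  rw [interior_Ioi] at ht
  have ht : 0 < t := ht
  rw [(hder t ht).deriv]
  have hx := div_pos hw ht
  have hE := Real.one_lt_exp_iff.2 hx
  rw [sub_pos, div_lt_one (pow_pos (by linarith) 2)]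
  exact key_ineq _ hx

/-- The exponential truncated mean
μ_MTuM(θ) = (e^{-d/θ}(d+θ) − e^{-u/θ}(u+θ)) / (e^{-d/θ} − e^{-u/θ})
is strictly increasing in θ on (0, ∞). -/
theorem stmt_4 (d u : ℝ) (hd : 0 ≤ d) (hdu : d < u) :
    StrictMonoOn
      (fun θ : ℝ =>
        (Real.exp (-d / θ) * (d + θ) - Real.exp (-u / θ) * (u + θ)) /
          (Real.exp (-d / θ) - Real.exp (-u / θ)))
      (Set.Ioi 0) := by
  refine StrictMonoOn.congr ((aux_mono (u - d) (sub_pos.2 hdu)).const_add d) ?_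
  intro t ht
  have ht : 0 < t := ht
  have hE := Real.one_lt_exp_iff.2 (div_pos (sub_pos.2 hdu) ht)
  have h1 : Real.exp (-d / t) = Real.exp (-u / t) * Real.exp ((u - d) / t) := by
    rw [← Real.exp_add]; congr 1; ring
  have hp := Real.exp_pos (-u / t)
  simp only [h1]
  generalize Real.exp ((u - d) / t) = E at *
  generalize Real.exp (-u / t) = U at *
  have hE' : E - 1 ≠ 0 := by linarith
  have h2 : U * E - U ≠ 0 := by
    have : U * E - U = U * (E - 1) := by ring
    rw [this]; exact mul_ne_zero hp.ne' hE'
  rw [eq_div_iff h2]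
  field_simp
  ring
end

section
/- For fixed thresholds 0 ≤ d < u and every θ > 0, the derivative of the truncated mean function satisfies μ_MTuM'(θ) = 1 − ((u−d)/(2θ))² / sinh²((u−d)/(2θ)); equivalently, μ_MTuM'(θ) = (p²θ² − e^{-(d+u)/θ}(u−d)²) / (p²θ²), where p = e^{-d/θ} − e^{-u/θ}. -/
open Real

/-- Derivative of the exponential truncated mean:
μ_MTuM'(θ) = 1 − ((u−d)/(2θ))² / sinh²((u−d)/(2θ))
           = (p²θ² − e^{-(d+u)/θ}(u−d)²)/(p²θ²), with p = e^{-d/θ} − e^{-u/θ}. -/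
theorem stmt_5 (d u : ℝ) (hd : 0 ≤ d) (hdu : d < u) (θ : ℝ) (hθ : 0 < θ)
    (p : ℝ) (hp : p = Real.exp (-d / θ) - Real.exp (-u / θ)) :
    (deriv (fun t : ℝ =>
        (Real.exp (-d / t) * (d + t) - Real.exp (-u / t) * (u + t)) /
          (Real.exp (-d / t) - Real.exp (-u / t))) θ
      = 1 - ((u - d) / (2 * θ)) ^ 2 / (Real.sinh ((u - d) / (2 * θ))) ^ 2) ∧
    (deriv (fun t : ℝ =>
        (Real.exp (-d / t) * (d + t) - Real.exp (-u / t) * (u + t)) /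
          (Real.exp (-d / t) - Real.exp (-u / t))) θ
      = (p ^ 2 * θ ^ 2 - Real.exp (-(d + u) / θ) * (u - d) ^ 2) / (p ^ 2 * θ ^ 2)) := by
  have hθ0 : θ ≠ 0 := hθ.ne'
  have hlt : Real.exp (-u / θ) < Real.exp (-d / θ) := by
    apply Real.exp_lt_exp.mpr
    apply div_lt_div_of_pos_right _ hθ
    linarith
  have hpp : 0 < p := by rw [hp]; linarith
  have hE : ∀ c : ℝ, HasDerivAt (fun t : ℝ => Real.exp (-c / t))
      (Real.exp (-c / θ) * (c / θ ^ 2)) θ := by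
    intro c
    have h := ((hasDerivAt_const θ (-c)).div (hasDerivAt_id θ) hθ0).exp
    refine h.congr_deriv ?_
    simp
  have hL : ∀ c : ℝ, HasDerivAt (fun t : ℝ => c + t) 1 θ := fun c =>
    (hasDerivAt_id θ).const_add c
  have hD := ((((hE d).mul (hL d)).sub ((hE u).mul (hL u))).div ((hE d).sub (hE u))
    (by simp only [Pi.sub_apply]; linarith)).deriv
  have hAB : Real.exp (-(d + u) / θ) = Real.exp (-d / θ) * Real.exp (-u / θ) := by
    rw [← Real.exp_add]; congr 1; ring
  have h2 : deriv (fun t : ℝ =>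
        (Real.exp (-d / t) * (d + t) - Real.exp (-u / t) * (u + t)) /
          (Real.exp (-d / t) - Real.exp (-u / t))) θ
      = (p ^ 2 * θ ^ 2 - Real.exp (-(d + u) / θ) * (u - d) ^ 2) / (p ^ 2 * θ ^ 2) := by
    refine hD.trans ?_
    simp only [Pi.sub_apply, Pi.mul_apply]
    rw [hAB, ← hp]
    have hA : Real.exp (-d / θ) = p + Real.exp (-u / θ) := by rw [hp]; ring
    rw [hA]
    field_simp
    ring
  refine ⟨?_, h2⟩
  rw [h2]
  have hs : 0 < Real.sinh ((u - d) / (2 * θ)) := by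
    apply Real.sinh_pos_iff.mpr
    apply div_pos <;> linarith
  have key : p ^ 2 = 4 * Real.exp (-(d + u) / θ) * Real.sinh ((u - d) / (2 * θ)) ^ 2 := by
    have e1 : Real.exp (-d / θ) =
        Real.exp (-(d + u) / (2 * θ)) * Real.exp ((u - d) / (2 * θ)) := by
      rw [← Real.exp_add]; congr 1; field_simp; ring
    have e2 : Real.exp (-u / θ) =
        Real.exp (-(d + u) / (2 * θ)) * Real.exp (-((u - d) / (2 * θ))) := by
      rw [← Real.exp_add]; congr 1; field_simp; ring
    have e3 : Real.exp (-(d + u) / θ) = Real.exp (-(d + u) / (2 * θ)) ^ 2 := by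
      rw [sq, ← Real.exp_add]; congr 1; field_simp; ring
    rw [hp, e1, e2, e3, Real.sinh_eq]
    ring
  rw [key]
  have he := Real.exp_pos (-(d + u) / θ)
  generalize Real.exp (-(d + u) / θ) = E at *
  generalize Real.sinh ((u - d) / (2 * θ)) = S at *
  have := hs.ne'
  have := he.ne'
  field_simp
  ring
end

section
/- For fixed thresholds 0 ≤ d < u, the truncated mean function satisfies lim_{θ → 0+} μ_MTuM(θ) = d, where μ_MTuM(θ) := (e^{-d/θ}(d+θ) − e^{-u/θ}(u+θ)) / (e^{-d/θ} − e^{-u/θ}). -/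
open Real Filter

/-- lim_{θ→0+} μ_MTuM(θ) = d for the exponential truncated mean. -/
theorem stmt_6 (d u : ℝ) (hd : 0 ≤ d) (hdu : d < u) :
    Filter.Tendsto
      (fun θ : ℝ =>
        (Real.exp (-d / θ) * (d + θ) - Real.exp (-u / θ) * (u + θ)) /
          (Real.exp (-d / θ) - Real.exp (-u / θ)))
      (nhdsWithin 0 (Set.Ioi 0)) (nhds d) := by
  have hr : Tendsto (fun θ : ℝ => Real.exp (-((u - d) * θ⁻¹)))
      (nhdsWithin 0 (Set.Ioi 0)) (nhds 0) :=
    Real.tendsto_exp_neg_atTop_nhds_zero.comp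
      (tendsto_inv_nhdsGT_zero.const_mul_atTop (sub_pos.mpr hdu))
  have ht : Tendsto (fun θ : ℝ => θ) (nhdsWithin 0 (Set.Ioi 0)) (nhds 0) :=
    tendsto_id.mono_left nhdsWithin_le_nhds
  have h := ((ht.const_add d).sub (hr.mul (ht.const_add u))).div (hr.const_sub 1) (by norm_num)
  have e : (d + 0 - 0 * (u + 0)) / (1 - 0) = d := by ring
  rw [e] at h
  refine h.congr fun θ => ?_
  have h1 : Real.exp (-u / θ) = Real.exp (-d / θ) * Real.exp (-((u - d) * θ⁻¹)) := by
    rw [← Real.exp_add]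
    congr 1
    ring
  rw [h1, mul_assoc, ← mul_sub, ← mul_one_sub, mul_div_mul_left _ _ (Real.exp_ne_zero _)]
  rfl
end

section
/- For fixed thresholds 0 ≤ d < u, the truncated mean function satisfies lim_{θ → ∞} μ_MTuM(θ) = (d+u)/2, where μ_MTuM(θ) := (e^{-d/θ}(d+θ) − e^{-u/θ}(u+θ)) / (e^{-d/θ} − e^{-u/θ}). -/
open Real Filter

lemma aux_two : Tendsto (fun s : ℝ => (Real.exp s - 1 - s) / s ^ 2)
    (nhdsWithin 0 (Set.Ioi 0)) (nhds (1 / 2)) := by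
  have h := (Real.exp_sub_sum_range_succ_isLittleO_pow 2).tendsto_div_nhds_zero
  have h2 := (h.mono_left (nhdsWithin_le_nhds (s := Set.Ioi (0:ℝ)))).add_const (1 / 2 : ℝ)
  rw [zero_add] at h2
  refine h2.congr' ?_
  filter_upwards [self_mem_nhdsWithin] with s hs
  have hs' : s ≠ 0 := ne_of_gt hs
  simp only [Finset.sum_range_succ, Finset.sum_range_zero, Nat.factorial]
  push_cast
  field_simp
  ring

lemma aux_one : Tendsto (fun s : ℝ => (Real.exp s - 1) / s)
    (nhdsWithin 0 (Set.Ioi 0)) (nhds 1) := by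
  have h := (Real.exp_sub_sum_range_succ_isLittleO_pow 1).tendsto_div_nhds_zero
  have h2 := (h.mono_left (nhdsWithin_le_nhds (s := Set.Ioi (0:ℝ)))).add_const (1 : ℝ)
  rw [zero_add] at h2
  refine h2.congr' ?_
  filter_upwards [self_mem_nhdsWithin] with s hs
  have hs' : s ≠ 0 := ne_of_gt hs
  simp only [Finset.sum_range_succ, Finset.sum_range_zero, Nat.factorial]
  push_cast
  field_simp
  ring

/-- lim_{θ→∞} μ_MTuM(θ) = (d+u)/2 for the exponential truncated mean. -/
theorem stmt_7 (d u : ℝ) (hd : 0 ≤ d) (hdu : d < u) :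
    Filter.Tendsto
      (fun θ : ℝ =>
        (Real.exp (-d / θ) * (d + θ) - Real.exp (-u / θ) * (u + θ)) /
          (Real.exp (-d / θ) - Real.exp (-u / θ)))
      Filter.atTop (nhds ((d + u) / 2)) := by
  have hh : 0 < u - d := sub_pos.2 hdu
  have hs : Tendsto (fun θ : ℝ => (u - d) / θ) atTop (nhdsWithin 0 (Set.Ioi 0)) := by
    refine tendsto_nhdsWithin_iff.2 ⟨tendsto_const_nhds.div_atTop tendsto_id, ?_⟩
    filter_upwards [eventually_gt_atTop 0] with θ hθ
    exact div_pos hh hθ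
  have key := (((aux_two.div aux_one one_ne_zero).comp hs).const_mul (u - d)).const_add d
  have e : d + (u - d) * (1 / 2 / 1) = (d + u) / 2 := by ring
  rw [e] at key
  refine key.congr' ?_
  filter_upwards [eventually_gt_atTop 0] with θ hθ
  have hsp : 0 < (u - d) / θ := div_pos hh hθ
  have hE : Real.exp (-d / θ) = Real.exp (-u / θ) * Real.exp ((u - d) / θ) := by
    rw [← Real.exp_add]; congr 1; ring
  have h1 : Real.exp ((u - d) / θ) - 1 ≠ 0 := by
    have := Real.add_one_lt_exp hsp.ne'
    linarith
  have h2 := (Real.exp_pos (-u / θ)).ne'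
  simp only [Function.comp, Pi.div_apply]
  rw [hE]
  generalize Real.exp (-u / θ) = b at *
  generalize Real.exp ((u - d) / θ) = a at *
  have h3 : b * a - b ≠ 0 := by
    have : b * a - b = b * (a - 1) := by ring
    rw [this]; exact mul_ne_zero h2 h1
  have hh' := hh.ne'
  have hθ' := hθ.ne'
  rw [eq_div_iff h3]
  field_simp
  ring
end

section
/- Fix thresholds 0 ≤ d < u and a real number m. The equation μ_MTuM(θ) = m has a solution θ ∈ (0, ∞) if and only if d < m < (d+u)/2, and in that case the solution is unique. Here μ_MTuM(θ) := (e^{-d/θ}(d+θ) − e^{-u/θ}(u+θ)) / (e^{-d/θ} − e^{-u/θ}). -/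
open Real

/-- The normalized truncated mean. -/
noncomputable def gAux (t : ℝ) : ℝ := 1 / t - 1 / (Real.exp t - 1)

lemma expm1_pos {t : ℝ} (ht : 0 < t) : 0 < Real.exp t - 1 := by
  have := Real.add_one_lt_exp ht.ne'
  linarith

lemma gAux_pos {t : ℝ} (ht : 0 < t) : 0 < gAux t := by
  have := Real.add_one_lt_exp ht.ne'
  unfold gAux
  have := one_div_lt_one_div_of_lt ht (show t < Real.exp t - 1 by linarith)
  linarith

lemma aux_h {t : ℝ} (ht : 0 < t) : 2 * (Real.exp t - 1) < t * (Real.exp t + 1) := by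
  have hm : StrictMonoOn (fun t : ℝ => t * (Real.exp t + 1) - 2 * (Real.exp t - 1)) (Set.Ici 0) := by
    apply strictMonoOn_of_deriv_pos (convex_Ici 0) (by fun_prop)
    intro x hx
    rw [interior_Ici] at hx
    have hx : 0 < x := hx
    have hder : HasDerivAt (fun t : ℝ => t * (Real.exp t + 1) - 2 * (Real.exp t - 1))
        ((1 * (Real.exp x + 1) + x * Real.exp x) - 2 * Real.exp x) x :=
      ((hasDerivAt_id x).mul ((Real.hasDerivAt_exp x).add_const 1)).sub
        (((Real.hasDerivAt_exp x).sub_const 1).const_mul 2)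
    rw [hder.deriv]
    have h1 := Real.add_one_lt_exp (neg_ne_zero.mpr hx.ne')
    have h2 : Real.exp (-x) * Real.exp x = 1 := by rw [← Real.exp_add]; simp
    have h3 := mul_lt_mul_of_pos_right h1 (Real.exp_pos x)
    nlinarith
  have := hm (Set.mem_Ici.mpr le_rfl) (Set.mem_Ici.mpr ht.le) ht
  simp at this
  linarith

lemma gAux_lt {t : ℝ} (ht : 0 < t) : gAux t < 1 / 2 := by
  have h1 := aux_h ht
  have h2 := expm1_pos ht
  unfold gAux
  rw [div_sub_div _ _ ht.ne' h2.ne', div_lt_div_iff₀ (by positivity) (by norm_num)]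
  nlinarith

lemma gAux_hasDerivAt {t : ℝ} (ht : 0 < t) :
    HasDerivAt gAux (-1 / t ^ 2 - (-Real.exp t / (Real.exp t - 1) ^ 2)) t := by
  have h2 := expm1_pos ht
  have := ((hasDerivAt_id t).inv ht.ne').sub (((Real.hasDerivAt_exp t).sub_const 1).inv h2.ne')
  refine this.congr_of_eventuallyEq (Filter.Eventually.of_forall fun x => ?_)
  simp [gAux]

lemma gAux_anti : StrictAntiOn gAux (Set.Ioi 0) := by
  apply strictAntiOn_of_deriv_neg (convex_Ioi 0)
  · intro x hx
    exact (gAux_hasDerivAt hx).continuousAt.continuousWithinAt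
  intro x hx
  rw [interior_Ioi] at hx
  have hx : 0 < x := hx
  rw [(gAux_hasDerivAt hx).deriv]
  have h2 := expm1_pos hx
  have h3 : x / 2 < Real.sinh (x / 2) := Real.self_lt_sinh_iff.mpr (by positivity)
  have h4 : x * Real.exp (x / 2) < Real.exp x - 1 := by
    rw [Real.sinh_eq] at h3
    have h5 : Real.exp (-(x/2)) * Real.exp (x/2) = 1 := by rw [← Real.exp_add]; simp
    have h6 : Real.exp (x/2) * Real.exp (x/2) = Real.exp x := by rw [← Real.exp_add]; simp
    nlinarith [mul_lt_mul_of_pos_right h3 (Real.exp_pos (x/2))]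
  have h7 : x ^ 2 * Real.exp x < (Real.exp x - 1) ^ 2 := by
    have h6 : Real.exp (x/2) * Real.exp (x/2) = Real.exp x := by rw [← Real.exp_add]; simp
    have := pow_lt_pow_left₀ h4 (by positivity) two_ne_zero
    calc x ^ 2 * Real.exp x = (x * Real.exp (x/2)) ^ 2 := by rw [← h6]; ring
      _ < _ := this
  have : Real.exp x / (Real.exp x - 1) ^ 2 < 1 / x ^ 2 := by
    rw [div_lt_div_iff₀ (by positivity) (by positivity)]
    linarith
  rw [neg_div, neg_div]
  linarith

lemma gAux_ge {t : ℝ} (ht : 0 < t) : 1 / (2 + t) ≤ gAux t := by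
  have h := Real.quadratic_le_exp_of_nonneg ht.le
  have h1 : 1 / (Real.exp t - 1) ≤ 1 / (t + t ^ 2 / 2) :=
    one_div_le_one_div_of_le (by positivity) (by linarith)
  have h2 : 1 / (2 + t) = 1 / t - 1 / (t + t ^ 2 / 2) := by
    field_simp
    ring
  unfold gAux
  linarith

lemma gAux_surj {c : ℝ} (h0 : 0 < c) (h1 : c < 1 / 2) : ∃ t, 0 < t ∧ gAux t = c := by
  have hk : 2 < 1 / c := by rw [lt_div_iff₀ h0]; linarith
  set k := 1 / c with hkd
  have hck : 1 / k = c := by simp [hkd]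
  have hs : 0 < k / 2 - 1 := by linarith
  have ha : c ≤ gAux (k / 2 - 1) := by
    refine le_trans ?_ (gAux_ge hs)
    rw [← hck]
    exact one_div_le_one_div_of_le (by linarith) (by linarith)
  have hb : gAux k ≤ c := by
    have := one_div_pos.mpr (expm1_pos (show 0 < k by linarith))
    unfold gAux
    linarith
  have hcont : ContinuousOn gAux (Set.Icc (k / 2 - 1) k) := fun x hx =>
    (gAux_hasDerivAt (hs.trans_le hx.1)).continuousAt.continuousWithinAt
  obtain ⟨t, ht, e⟩ := intermediate_value_Icc' (by linarith) hcont ⟨hb, ha⟩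
  exact ⟨t, hs.trans_le ht.1, e⟩

lemma mu_eq {d u θ : ℝ} (hdu : d < u) (hθ : 0 < θ) :
    (Real.exp (-d / θ) * (d + θ) - Real.exp (-u / θ) * (u + θ)) /
        (Real.exp (-d / θ) - Real.exp (-u / θ)) = d + (u - d) * gAux ((u - d) / θ) := by
  have hw : 0 < u - d := by linarith
  have h2 := expm1_pos (div_pos hw hθ)
  have hE : Real.exp (-d / θ) = Real.exp (-u / θ) * Real.exp ((u - d) / θ) := by
    rw [← Real.exp_add]; congr 1; ring
  have hp := Real.exp_pos (-u / θ)
  unfold gAux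
  rw [hE]
  generalize Real.exp (-u / θ) = a at *
  generalize Real.exp ((u - d) / θ) = b at *
  have h3 : a * b - a ≠ 0 := by
    have : a * b - a = a * (b - 1) := by ring
    rw [this]; positivity
  have h4 := h2.ne'
  rw [div_eq_iff h3]
  field_simp
  ring

/-- The MTuM estimating equation μ_MTuM(θ) = m for the exponential parameter
has a solution θ ∈ (0,∞) iff d < m < (d+u)/2, and then the solution is unique. -/
theorem stmt_8 (d u m : ℝ) (hd : 0 ≤ d) (hdu : d < u)
    (μMTuM : ℝ → ℝ)
    (hμ : ∀ θ : ℝ, μMTuM θ =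
      (Real.exp (-d / θ) * (d + θ) - Real.exp (-u / θ) * (u + θ)) /
        (Real.exp (-d / θ) - Real.exp (-u / θ))) :
    ((∃ θ : ℝ, 0 < θ ∧ μMTuM θ = m) ↔ (d < m ∧ m < (d + u) / 2)) ∧
    (d < m → m < (d + u) / 2 → ∃! θ : ℝ, 0 < θ ∧ μMTuM θ = m) := by
  have hw : 0 < u - d := by linarith
  have hM : ∀ θ : ℝ, 0 < θ → μMTuM θ = d + (u - d) * gAux ((u - d) / θ) :=
    fun θ hθ => (hμ θ).trans (mu_eq hdu hθ)
  have hex : d < m → m < (d + u) / 2 → ∃ θ : ℝ, 0 < θ ∧ μMTuM θ = m := by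
    intro h1 h2
    obtain ⟨t, ht, e⟩ := gAux_surj (c := (m - d) / (u - d)) (div_pos (by linarith) hw)
      (by rw [div_lt_iff₀ hw]; linarith)
    refine ⟨(u - d) / t, div_pos hw ht, ?_⟩
    rw [hM _ (div_pos hw ht), div_div_cancel₀ hw.ne', e, mul_div_cancel₀ _ hw.ne']
    ring
  refine ⟨⟨?_, fun h => hex h.1 h.2⟩, ?_⟩
  · rintro ⟨θ, hθ, rfl⟩
    rw [hM θ hθ]
    have hp := gAux_pos (div_pos hw hθ)
    have hl := gAux_lt (div_pos hw hθ)
    constructor <;> nlinarith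
  · intro h1 h2
    obtain ⟨θ, hθ, e⟩ := hex h1 h2
    refine ⟨θ, ⟨hθ, e⟩, ?_⟩
    rintro η ⟨hη, e'⟩
    rw [hM _ hθ] at e
    rw [hM _ hη] at e'
    have h3 : gAux ((u - d) / η) = gAux ((u - d) / θ) :=
      mul_left_cancel₀ hw.ne' (by linarith)
    have h4 := gAux_anti.injOn (Set.mem_Ioi.mpr (div_pos hw hη)) (Set.mem_Ioi.mpr (div_pos hw hθ)) h3
    rw [div_eq_div_iff hη.ne' hθ.ne'] at h4
    exact (mul_left_cancel₀ hw.ne' h4).symm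
end

section
/- Let θ₁ ≠ θ₂ be two positive exponential parameters with corresponding truncation thresholds 0 ≤ d₁ < u₁ and 0 ≤ d₂ < u₂. If e^{-d₁/θ₁} = e^{-d₂/θ₂} and e^{-u₁/θ₁} = e^{-u₂/θ₂} (i.e., the tail probabilities F(d|θ) and 1 − F(u|θ) are the same for both), then ARE_MTuM(θ₁, d₁, u₁) = ARE_MTuM(θ₂, d₂, u₂), where ARE_MTuM(θ, d, u) := (p²θ² − e^{-(d+u)/θ}(u−d)²) / (pθ²) with p = e^{-d/θ} − e^{-u/θ}. -/
open Real

/-- Stability of the MTuM asymptotic relative efficiency: if the tail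
probabilities of two exponential models with their truncation thresholds agree,
then the AREs agree. -/
theorem stmt_9 (θ₁ θ₂ d₁ u₁ d₂ u₂ : ℝ)
    (hθ₁ : 0 < θ₁) (hθ₂ : 0 < θ₂) (hθ : θ₁ ≠ θ₂)
    (hd₁ : 0 ≤ d₁) (hdu₁ : d₁ < u₁) (hd₂ : 0 ≤ d₂) (hdu₂ : d₂ < u₂)
    (hlow : Real.exp (-d₁ / θ₁) = Real.exp (-d₂ / θ₂))
    (hup : Real.exp (-u₁ / θ₁) = Real.exp (-u₂ / θ₂))
    (ARE : ℝ → ℝ → ℝ → ℝ)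
    (hARE : ∀ θ d u, ARE θ d u =
      ((Real.exp (-d / θ) - Real.exp (-u / θ)) ^ 2 * θ ^ 2
          - Real.exp (-(d + u) / θ) * (u - d) ^ 2) /
        ((Real.exp (-d / θ) - Real.exp (-u / θ)) * θ ^ 2)) :
    ARE θ₁ d₁ u₁ = ARE θ₂ d₂ u₂ := by
  have key : ∀ θ d u : ℝ, 0 < θ → ARE θ d u =
      ((Real.exp (-d / θ) - Real.exp (-u / θ)) ^ 2
        - Real.exp (-d / θ) * Real.exp (-u / θ) * (-d / θ - -u / θ) ^ 2) /
        (Real.exp (-d / θ) - Real.exp (-u / θ)) := by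
    intro θ d u h
    have hne : θ ^ 2 ≠ 0 := by positivity
    have he : Real.exp (-(d + u) / θ) = Real.exp (-d / θ) * Real.exp (-u / θ) := by
      rw [← Real.exp_add]
      congr 1
      ring
    have hs : (u - d) ^ 2 = (-d / θ - -u / θ) ^ 2 * θ ^ 2 := by
      field_simp
      ring
    rw [hARE, he, hs, ← mul_assoc, ← sub_mul, mul_div_mul_right _ _ hne]
  rw [key _ _ _ hθ₁, key _ _ _ hθ₂, Real.exp_injective hlow, Real.exp_injective hup]
end

section
/- Fix 0 < x₀ ≤ d < u. The function g_{du}(α) := [u^α(1 − α·log(x₀/d)) − d^α(1 − α·log(x₀/u))] / (α(u^α − d^α)) is strictly decreasing in α on (0, ∞). -/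
open Real Set

lemma aux_ineq (t : ℝ) (ht : 0 < t) : t ^ 2 * Real.exp t < (Real.exp t - 1) ^ 2 := by
  have h := Real.self_lt_sinh_iff.2 (half_pos ht)
  rw [Real.sinh_eq, Real.exp_neg] at h
  have hs : Real.exp t = Real.exp (t / 2) ^ 2 := by
    rw [← Real.exp_nat_mul]; congr 1; push_cast; ring
  have hp := Real.exp_pos (t / 2)
  rw [hs]
  generalize Real.exp (t / 2) = s at *
  have h1 : t * s < s ^ 2 - 1 := by
    have h2 : t < s - s⁻¹ := by linarith
    have := mul_lt_mul_of_pos_right h2 hp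
    have e : (s - s⁻¹) * s = s ^ 2 - 1 := by field_simp
    linarith
  have h0 : 0 < t * s := mul_pos ht hp
  nlinarith

lemma aux_anti (L : ℝ) (hL : 0 < L) :
    StrictAntiOn (fun α : ℝ => α⁻¹ - L * (Real.exp (α * L) - 1)⁻¹) (Set.Ioi 0) := by
  have hd : ∀ α : ℝ, 0 < α → HasDerivAt (fun α : ℝ => α⁻¹ - L * (Real.exp (α * L) - 1)⁻¹)
      (-(α ^ 2)⁻¹ - L * (-(Real.exp (α * L) * (1 * L)) / (Real.exp (α * L) - 1) ^ 2)) α := by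
    intro α hα
    have hne : Real.exp (α * L) - 1 ≠ 0 := by
      have := Real.add_one_lt_exp (mul_pos hα hL).ne'
      have := mul_pos hα hL
      intro h; linarith
    exact (hasDerivAt_inv hα.ne').sub
      (((((hasDerivAt_id α).mul_const L).exp.sub_const 1).fun_inv hne).const_mul L)
  apply strictAntiOn_of_deriv_neg (convex_Ioi 0)
  · intro α hα
    exact (hd α hα).continuousAt.continuousWithinAt
  · intro α hα
    rw [interior_Ioi] at hα
    have hα' : 0 < α := hα
    rw [(hd α hα').deriv]
    have ht := mul_pos hα' hL
    have h := aux_ineq _ ht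
    have hE : 0 < Real.exp (α * L) - 1 := by
      have := Real.add_one_lt_exp ht.ne'
      linarith
    generalize Real.exp (α * L) = E at *
    have : L ^ 2 * E / (E - 1) ^ 2 < 1 / α ^ 2 := by
      rw [div_lt_div_iff₀ (by positivity) (by positivity)]
      nlinarith
    have e : -(α ^ 2)⁻¹ - L * (-(E * (1 * L)) / (E - 1) ^ 2)
        = L ^ 2 * E / (E - 1) ^ 2 - 1 / α ^ 2 := by ring
    rw [e]; linarith

/-- The Pareto I truncated moment function
g_{du}(α) = [u^α(1 − α log(x₀/d)) − d^α(1 − α log(x₀/u))]/(α(u^α − d^α))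
is strictly decreasing in α on (0, ∞). -/
theorem stmt_11 (x₀ d u : ℝ) (hx₀ : 0 < x₀) (hxd : x₀ ≤ d) (hdu : d < u) :
    StrictAntiOn
      (fun α : ℝ =>
        (u ^ α * (1 - α * Real.log (x₀ / d)) - d ^ α * (1 - α * Real.log (x₀ / u))) /
          (α * (u ^ α - d ^ α)))
      (Set.Ioi 0) := by
  have hd : 0 < d := lt_of_lt_of_le hx₀ hxd
  have hu : 0 < u := hd.trans hdu
  have hL : 0 < Real.log u - Real.log d := sub_pos.2 (Real.log_lt_log hd hdu)
  have key : ∀ α ∈ Set.Ioi (0 : ℝ),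
      (u ^ α * (1 - α * Real.log (x₀ / d)) - d ^ α * (1 - α * Real.log (x₀ / u))) /
          (α * (u ^ α - d ^ α)) = (α⁻¹ - (Real.log u - Real.log d) *
            (Real.exp (α * (Real.log u - Real.log d)) - 1)⁻¹)
            + (Real.log d - Real.log x₀) := by
    intro α hα
    have hα' : 0 < α := hα
    have hlt : 0 < u ^ α - d ^ α := sub_pos.2 (Real.rpow_lt_rpow hd.le hdu hα')
    have hD : 0 < d ^ α := Real.rpow_pos_of_pos hd α
    have hE : Real.exp (α * (Real.log u - Real.log d)) = u ^ α / d ^ α := by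
      rw [Real.rpow_def_of_pos hu, Real.rpow_def_of_pos hd, ← Real.exp_sub]
      congr 1; ring
    rw [hE, Real.log_div hx₀.ne' hd.ne', Real.log_div hx₀.ne' hu.ne']
    generalize u ^ α = U at *
    generalize d ^ α = D at *
    have e : (U / D - 1)⁻¹ = D / (U - D) := by
      rw [div_sub_one hD.ne', inv_div]
    rw [e]
    have := hlt.ne'
    field_simp
    ring
  intro a ha b hb hab
  have := aux_anti _ hL ha hb hab
  simp only at this ⊢
  rw [key a ha, key b hb]
  linarith
end

section
/- Fix 0 < x₀ ≤ d < u, let g_{du}(α) := [u^α(1 − α·log(x₀/d)) − d^α(1 − α·log(x₀/u))] / (α(u^α − d^α)), and let m be a real number. The equation g_{du}(α) = m has a solution α ∈ (0, ∞) if and only if log(d/x₀) < m < [(log u)² − (log d)² − 2·log(u)·log(x₀/d) + 2·log(d)·log(x₀/u)] / (2·log(u/d)), and in that case the solution is unique. -/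
open Real

/-- The normalized truncated mean. -/
noncomputable def hfun (t : ℝ) : ℝ := 1 / t - 1 / (Real.exp t - 1)

lemma hfun_hasDeriv {t : ℝ} (ht : 0 < t) :
    HasDerivAt hfun (-1 / t ^ 2 + Real.exp t / (Real.exp t - 1) ^ 2) t := by
  have h0 := expm1_pos ht
  have h1 : HasDerivAt (fun t : ℝ => 1 / t) (-1 / t ^ 2) t := by
    simpa [neg_div] using hasDerivAt_inv ht.ne'
  have h2 : HasDerivAt (fun t : ℝ => Real.exp t - 1) (Real.exp t) t :=
    (Real.hasDerivAt_exp t).sub_const 1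
  have h3 := h2.inv h0.ne'
  have h4 := h1.sub h3
  have e1 : hfun = (fun t : ℝ => 1 / t) - (fun t : ℝ => Real.exp t - 1)⁻¹ := by
    funext s
    simp [hfun]
  have e2 : -1 / t ^ 2 + Real.exp t / (Real.exp t - 1) ^ 2
      = -1 / t ^ 2 - -Real.exp t / (Real.exp t - 1) ^ 2 := by ring
  rw [e1, e2]
  exact h4

lemma hfun_cont : ContinuousOn hfun (Set.Ioi 0) := fun t ht =>
  (hfun_hasDeriv ht).continuousAt.continuousWithinAt

lemma hfun_anti : StrictAntiOn hfun (Set.Ioi 0) := by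
  apply strictAntiOn_of_deriv_neg (convex_Ioi 0) hfun_cont
  intro t ht
  rw [interior_Ioi] at ht
  have ht : 0 < t := ht
  rw [(hfun_hasDeriv ht).deriv]
  have h0 := expm1_pos ht
  have hs : t / 2 < Real.sinh (t / 2) := Real.self_lt_sinh_iff.2 (by linarith)
  rw [Real.sinh_eq] at hs
  have ha : 0 < Real.exp (t / 2) := Real.exp_pos _
  have hb : Real.exp t = Real.exp (t / 2) * Real.exp (t / 2) := by
    rw [← Real.exp_add]; congr 1; ring
  have hc : Real.exp (-(t / 2)) * Real.exp (t / 2) = 1 := by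
    rw [← Real.exp_add]; simp
  have key : t * Real.exp (t / 2) < Real.exp t - 1 := by nlinarith
  have hk2 : (t * Real.exp (t / 2)) ^ 2 < (Real.exp t - 1) ^ 2 :=
    pow_lt_pow_left₀ key (by positivity) (by norm_num)
  have : Real.exp t / (Real.exp t - 1) ^ 2 < 1 / t ^ 2 := by
    rw [div_lt_div_iff₀ (by positivity) (by positivity)]
    nlinarith
  rw [neg_div]
  linarith

lemma hfun_ge {t : ℝ} (ht : 0 < t) : 1 / (2 + t) ≤ hfun t := by
  have h0 := expm1_pos ht
  have h1 := Real.quadratic_le_exp_of_nonneg ht.le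
  have h2 : 1 / (Real.exp t - 1) ≤ 1 / (t + t ^ 2 / 2) :=
    one_div_le_one_div_of_le (by positivity) (by linarith)
  have h3 : 1 / (2 + t) = 1 / t - 1 / (t + t ^ 2 / 2) := by
    have : t + t ^ 2 / 2 = t * (2 + t) / 2 := by ring
    rw [this]
    field_simp
    ring
  unfold hfun
  linarith

lemma hfun_lt_inv {t : ℝ} (ht : 0 < t) : hfun t < 1 / t := by
  have := one_div_pos.2 (expm1_pos ht)
  unfold hfun
  linarith

lemma hfun_lt_half {t : ℝ} (ht : 0 < t) : hfun t < 1 / 2 := by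
  have h0 := expm1_pos ht
  have hd : ∀ s : ℝ, HasDerivAt (fun s : ℝ => s * (Real.exp s + 1) - 2 * (Real.exp s - 1))
      (s * Real.exp s + 1 - Real.exp s) s := by
    intro s
    have := ((hasDerivAt_id s).mul ((Real.hasDerivAt_exp s).add_const 1)).sub
      (((Real.hasDerivAt_exp s).sub_const 1).const_mul 2)
    have e : s * Real.exp s + 1 - Real.exp s
        = 1 * (Real.exp s + 1) + id s * Real.exp s - 2 * Real.exp s := by
      simp only [id]
      ring
    rw [e]
    exact this
  have hm : StrictMonoOn (fun s : ℝ => s * (Real.exp s + 1) - 2 * (Real.exp s - 1))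
      (Set.Ici 0) := by
    apply strictMonoOn_of_deriv_pos (convex_Ici 0)
    · exact fun s _ => (hd s).continuousAt.continuousWithinAt
    · intro s hs
      rw [interior_Ici] at hs
      have hs : 0 < s := hs
      rw [(hd s).deriv]
      have h1 := Real.add_one_lt_exp (neg_ne_zero.2 hs.ne')
      have h2 : Real.exp (-s) * Real.exp s = 1 := by rw [← Real.exp_add]; simp
      nlinarith [Real.exp_pos s]
  have := hm (Set.mem_Ici.2 le_rfl) (Set.mem_Ici.2 ht.le) ht
  simp only [Real.exp_zero] at this
  unfold hfun
  rw [div_sub_div _ _ ht.ne' h0.ne', div_lt_div_iff₀ (by positivity) (by norm_num)]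
  nlinarith

lemma hfun_exists {y : ℝ} (hy : 0 < y) (hy2 : y < 1 / 2) : ∃ t, 0 < t ∧ hfun t = y := by
  have h1 : 2 < 1 / y := by rw [lt_div_iff₀ hy]; linarith
  have ha := hfun_ge (t := 1 / y - 2) (by linarith)
  have hb := hfun_lt_inv (t := 1 / y) (by linarith)
  simp only [add_sub_cancel, one_div_one_div] at ha hb
  have hc : ContinuousOn hfun (Set.Icc (1 / y - 2) (1 / y)) :=
    hfun_cont.mono fun t ht => by
      have := ht.1
      simp only [Set.mem_Ioi]
      linarith
  obtain ⟨t, ht, he⟩ := intermediate_value_Icc' (by linarith) hc ⟨hb.le, ha⟩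
  exact ⟨t, by have := ht.1; linarith, he⟩

/-- The Pareto I MTuM estimating equation g_{du}(α) = m has a solution
α ∈ (0,∞) iff log(d/x₀) < m < the α→0+ limit of g_{du}; and then it is unique. -/
theorem stmt_13 (x₀ d u m : ℝ) (hx₀ : 0 < x₀) (hxd : x₀ ≤ d) (hdu : d < u)
    (g : ℝ → ℝ)
    (hg : ∀ α : ℝ, g α =
      (u ^ α * (1 - α * Real.log (x₀ / d)) - d ^ α * (1 - α * Real.log (x₀ / u))) /
        (α * (u ^ α - d ^ α))) :
    ((∃ α : ℝ, 0 < α ∧ g α = m) ↔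
      (Real.log (d / x₀) < m ∧
        m < ((Real.log u) ^ 2 - (Real.log d) ^ 2
          - 2 * Real.log u * Real.log (x₀ / d)
          + 2 * Real.log d * Real.log (x₀ / u)) / (2 * Real.log (u / d)))) ∧
    (Real.log (d / x₀) < m →
      m < ((Real.log u) ^ 2 - (Real.log d) ^ 2
        - 2 * Real.log u * Real.log (x₀ / d)
        + 2 * Real.log d * Real.log (x₀ / u)) / (2 * Real.log (u / d)) →
      ∃! α : ℝ, 0 < α ∧ g α = m) := by
  have hd : 0 < d := lt_of_lt_of_le hx₀ hxd
  have hu : 0 < u := hd.trans hdu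
  have hL : 0 < Real.log u - Real.log d := sub_pos.2 (Real.log_lt_log hd hdu)
  rw [Real.log_div hx₀.ne' hd.ne', Real.log_div hx₀.ne' hu.ne', Real.log_div hd.ne' hx₀.ne', Real.log_div hu.ne' hd.ne']
  have hB : ((Real.log u) ^ 2 - (Real.log d) ^ 2
          - 2 * Real.log u * (Real.log x₀ - Real.log d)
          + 2 * Real.log d * (Real.log x₀ - Real.log u)) / (2 * (Real.log u - Real.log d))
      = (Real.log d - Real.log x₀) + (Real.log u - Real.log d) * (1 / 2) := by
    field_simp
    ring
  rw [hB]
  have hgα : ∀ α : ℝ, 0 < α → g α = (Real.log d - Real.log x₀)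
      + (Real.log u - Real.log d) * hfun (α * (Real.log u - Real.log d)) := by
    intro α hα
    have ht : 0 < α * (Real.log u - Real.log d) := mul_pos hα hL
    have h0 := expm1_pos ht
    have hdα : 0 < d ^ α := Real.rpow_pos_of_pos hd α
    have huα : u ^ α = d ^ α * Real.exp (α * (Real.log u - Real.log d)) := by
      rw [Real.rpow_def_of_pos hu, Real.rpow_def_of_pos hd, ← Real.exp_add]
      congr 1
      ring
    rw [hg, Real.log_div hx₀.ne' hd.ne', Real.log_div hx₀.ne' hu.ne', huα]
    unfold hfun
    generalize Real.exp (α * (Real.log u - Real.log d)) = E at *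
    have h1 : d ^ α * E - d ^ α = d ^ α * (E - 1) := by ring
    rw [h1]
    have hα' := hα.ne'
    have hL' := hL.ne'
    have h0' := h0.ne'
    have hdα' := hdα.ne'
    field_simp
    ring
  generalize Real.log u - Real.log d = L at *
  generalize Real.log d - Real.log x₀ = c at *
  have huniq : c < m → m < c + L * (1 / 2) → ∃! α : ℝ, 0 < α ∧ g α = m := by
    intro h1 h2
    obtain ⟨t, ht, he⟩ := hfun_exists (y := (m - c) / L) (div_pos (by linarith) hL)
      (by rw [div_lt_iff₀ hL]; linarith)
    refine ⟨t / L, ⟨div_pos ht hL, ?_⟩, ?_⟩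
    · rw [hgα _ (div_pos ht hL), div_mul_cancel₀ _ hL.ne', he, mul_div_cancel₀ _ hL.ne']
      ring
    · rintro β ⟨hβ, hm⟩
      rw [hgα β hβ] at hm
      have : hfun (β * L) = hfun t := by
        rw [he, eq_div_iff hL.ne']
        linarith
      have := hfun_anti.injOn (Set.mem_Ioi.2 (mul_pos hβ hL)) (Set.mem_Ioi.2 ht) this
      rw [eq_div_iff hL.ne', this]
  refine ⟨⟨?_, fun h => (huniq h.1 h.2).exists⟩, huniq⟩
  rintro ⟨α, hα, rfl⟩
  rw [hgα α hα]
  have ht := mul_pos hα hL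
  have h1 : 0 < hfun (α * L) := lt_of_lt_of_le (by positivity) (hfun_ge ht)
  have h2 := hfun_lt_half ht
  constructor
  · nlinarith
  · nlinarith
end

section
/- Fix thresholds 0 ≤ d < u and a real number m. The equation ψ(θ) = m, where ψ(θ) := d + θ(e^{-d/θ} − e^{-u/θ}) is the censored mean E[min(max(d, X), u)] for X ~ Exp(θ), has a solution θ ∈ (0, ∞) if and only if d < m < u, and in that case the solution is unique. -/
open Real

/-- The MCM estimating equation ψ(θ) = m, ψ(θ) = d + θ(e^{-d/θ} − e^{-u/θ})
(the censored mean of Exp(θ)), has a solution θ ∈ (0,∞) iff d < m < u,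
and then the solution is unique. -/
theorem stmt_15 (d u m : ℝ) (hd : 0 ≤ d) (hdu : d < u)
    (ψ : ℝ → ℝ)
    (hψ : ∀ θ : ℝ, ψ θ = d + θ * (Real.exp (-d / θ) - Real.exp (-u / θ))) :
    ((∃ θ : ℝ, 0 < θ ∧ ψ θ = m) ↔ (d < m ∧ m < u)) ∧
    (d < m → m < u → ∃! θ : ℝ, 0 < θ ∧ ψ θ = m) := by
  have hder : ∀ θ : ℝ, 0 < θ → HasDerivAt ψ
      ((1 + d / θ) * Real.exp (-(d / θ)) - (1 + u / θ) * Real.exp (-(u / θ))) θ := by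
    intro θ hθ
    have hne := hθ.ne'
    have key : ∀ c : ℝ, HasDerivAt (fun x : ℝ => Real.exp (-c / x))
        (Real.exp (-c / θ) * (c / θ ^ 2)) θ := by
      intro c
      have h := ((hasDerivAt_const θ (-c)).div (hasDerivAt_id θ) hne).exp
      refine HasDerivAt.congr_deriv (f' := Real.exp (-c / θ) * ((0 * θ - -c * 1) / θ ^ 2)) h ?_
      ring
    have h := ((hasDerivAt_id θ).mul ((key d).sub (key u))).const_add d
    have he : ψ = fun x => d + x * (Real.exp (-d / x) - Real.exp (-u / x)) := funext hψ
    rw [he]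
    refine HasDerivAt.congr_deriv (f' := 1 * (Real.exp (-d / θ) - Real.exp (-u / θ)) +
      θ * (Real.exp (-d / θ) * (d / θ ^ 2) - Real.exp (-u / θ) * (u / θ ^ 2))) h ?_
    simp only [neg_div]
    field_simp
    ring
  have hmono : StrictMonoOn ψ (Set.Ioi 0) := by
    apply strictMonoOn_of_deriv_pos (convex_Ioi 0)
    · intro x hx
      exact (hder x hx).continuousAt.continuousWithinAt
    · intro x hx
      rw [interior_Ioi] at hx
      have hx' : 0 < x := hx
      rw [(hder x hx).deriv]
      have ha : 0 ≤ d / x := by positivity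
      have hab : d / x < u / x := by gcongr
      generalize d / x = a at *
      generalize u / x = b at *
      have h1 : b - a + 1 < Real.exp (b - a) := Real.add_one_lt_exp (by linarith)
      have h2 : Real.exp (-a) = Real.exp (b - a) * Real.exp (-b) := by
        rw [← Real.exp_add]; ring_nf
      rw [h2]
      have h3 : 1 + b < (1 + a) * Real.exp (b - a) := by
        nlinarith [mul_nonneg ha (sub_nonneg.2 hab.le)]
      nlinarith [Real.exp_pos (-b)]
  have hlow : ∀ θ : ℝ, 0 < θ → d < ψ θ := by
    intro θ hθ
    rw [hψ]
    have : Real.exp (-u / θ) < Real.exp (-d / θ) := by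
      apply Real.exp_lt_exp.2
      gcongr
    nlinarith [mul_pos hθ (sub_pos.2 this)]
  have hup : ∀ θ : ℝ, 0 < θ → ψ θ < u := by
    intro θ hθ
    rw [hψ]
    have h1 : Real.exp (-u / θ) = Real.exp (-d / θ) * Real.exp (-((u - d) / θ)) := by
      rw [← Real.exp_add]; ring_nf
    have hpos : 0 < (u - d) / θ := div_pos (by linarith) hθ
    have h2 : -((u - d) / θ) + 1 < Real.exp (-((u - d) / θ)) :=
      Real.add_one_lt_exp (by linarith)
    have h3 : Real.exp (-d / θ) ≤ 1 := by
      apply Real.exp_le_one_iff.2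
      rw [neg_div]
      have : 0 ≤ d / θ := by positivity
      linarith
    have h4 : Real.exp (-((u - d) / θ)) < 1 := by
      rw [← Real.exp_zero]; exact Real.exp_lt_exp.2 (by linarith)
    have h5 : Real.exp (-d / θ) - Real.exp (-u / θ) < (u - d) / θ := by
      rw [h1]
      nlinarith
    have := (lt_div_iff₀ hθ).1 h5
    linarith
  have hex : d < m → m < u → ∃ θ : ℝ, 0 < θ ∧ ψ θ = m := by
    intro h1 h2
    have hu : 0 < u := by linarith
    have hp1 : 0 < m - d := by linarith
    have hum : 0 < u - m := by linarith
    have hud : 0 < u - d := by linarith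
    have hp2 : 0 < u * (u - d) / (u - m) := by positivity
    have hA : ψ (m - d) ≤ m := by
      rw [hψ]
      have h3 : Real.exp (-d / (m - d)) ≤ 1 := by
        apply Real.exp_le_one_iff.2
        rw [neg_div]
        have : 0 ≤ d / (m - d) := by positivity
        linarith
      nlinarith [Real.exp_pos (-u / (m - d))]
    have hB : m ≤ ψ (u * (u - d) / (u - m)) := by
      have hq : u * (u - d) / (u * (u - d) / (u - m)) = u - m := by
        field_simp
      generalize u * (u - d) / (u - m) = θ at *
      rw [hψ]
      have e1 : Real.exp (-d / θ) = Real.exp (-u / θ) * Real.exp ((u - d) / θ) := by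
        rw [← Real.exp_add]; ring_nf
      have e2 := Real.add_one_le_exp ((u - d) / θ)
      have e3 := Real.add_one_le_exp (-u / θ)
      have e4 := Real.exp_pos (-u / θ)
      have e5 : Real.exp (-u / θ) * ((u - d) / θ) ≤ Real.exp (-d / θ) - Real.exp (-u / θ) := by
        rw [e1]; nlinarith
      have e6 := mul_le_mul_of_nonneg_left e5 hp2.le
      have e7 : θ * (Real.exp (-u / θ) * ((u - d) / θ)) = Real.exp (-u / θ) * (u - d) := by
        field_simp
      have e8 := mul_le_mul_of_nonneg_right e3 hud.le
      have e9 : (-u / θ + 1) * (u - d) = (u - d) - u * (u - d) / θ := by ring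
      linarith
    have hc : ContinuousOn ψ (Set.Ioi 0) := fun x hx =>
      (hder x hx).continuousAt.continuousWithinAt
    obtain ⟨θ, hθ, h⟩ := isPreconnected_Ioi.intermediate_value (a := m - d)
      (b := u * (u - d) / (u - m)) hp1 hp2 hc ⟨hA, hB⟩
    exact ⟨θ, hθ, h⟩
  refine ⟨⟨?_, fun h => hex h.1 h.2⟩, fun h1 h2 => ?_⟩
  · rintro ⟨θ, hθ, rfl⟩
    exact ⟨hlow θ hθ, hup θ hθ⟩
  · obtain ⟨θ, hθ, h⟩ := hex h1 h2
    refine ⟨θ, ⟨hθ, h⟩, ?_⟩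
    rintro y ⟨hy, hy'⟩
    exact hmono.injOn hy hθ (hy'.trans h.symm)
end

section
/- Let θ > 0 and let 0 < a, 0 < b with a + b < 1. Set d := −θ·log(1−a) and u := −θ·log(b), so that F(d|θ) = a and 1 − F(u|θ) = b for the Exp(θ) cdf. Let Z := min(max(d, X), u) for X ~ Exp(θ) and let σ²_MCM := E[Z²] − (E[Z])² be its variance. Then σ²_MCM / θ² = J(a, 1−b), where J(a, 1−b) := ∫_a^{1−b} ∫_a^{1−b} (min{v, w} − vw) / ((1−v)(1−w)) dw dv. Consequently, with I(a, 1−b) := ∫_a^{1−b} log(1−v) dv, the asymptotic relative efficiency of the method-of-censored-moments estimator, (d + θ(e^{-d/θ} − e^{-u/θ}) − u·e^{-u/θ}·0 … )² — explicitly, ARE_MCM := (pθ + d·e^{-d/θ} − u·e^{-u/θ})² / σ²_MCM with p = e^{-d/θ} − e^{-u/θ} — equals [I(a, 1−b)]² / J(a, 1−b), the asymptotic relative efficiency of the method-of-trimmed-moments estimator. -/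
open Real MeasureTheory

theorem aux_deriv_exp (θ : ℝ) (hθ : 0 < θ) (x : ℝ) :
    HasDerivAt (fun x : ℝ => Real.exp (-x / θ)) (-((1 / θ) * Real.exp (-x / θ))) x := by
  have h := (((hasDerivAt_id x).neg).div_const θ).exp
  refine HasDerivAt.congr_deriv h ?_
  simp only [Pi.neg_apply, id_eq]
  ring

theorem aux_int_Ioi (θ : ℝ) (hθ : 0 < θ) (u : ℝ) :
    IntegrableOn (fun x : ℝ => (1 / θ) * Real.exp (-x / θ)) (Set.Ioi u) ∧
    ∫ x in Set.Ioi u, (1 / θ) * Real.exp (-x / θ) = Real.exp (-u / θ) := by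
  have hd : ∀ x ∈ Set.Ici u, HasDerivAt (fun x : ℝ => -Real.exp (-x / θ))
      ((1 / θ) * Real.exp (-x / θ)) x := by
    intro x _
    refine HasDerivAt.congr_deriv (aux_deriv_exp θ hθ x).neg ?_; ring
  have ht : Filter.Tendsto (fun x : ℝ => -Real.exp (-x / θ)) Filter.atTop (nhds 0) := by
    have : Filter.Tendsto (fun x : ℝ => Real.exp (-x / θ)) Filter.atTop (nhds 0) := by
      refine Real.tendsto_exp_atBot.comp ?_
      exact Filter.Tendsto.atBot_div_const hθ Filter.tendsto_neg_atTop_atBot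
    simpa using this.neg
  have hp : ∀ x ∈ Set.Ioi u, 0 ≤ (1 / θ) * Real.exp (-x / θ) := by
    intro x _; positivity
  refine ⟨integrableOn_Ioi_deriv_of_nonneg' hd hp ht, ?_⟩
  rw [integral_Ioi_of_hasDerivAt_of_nonneg' hd hp ht]
  ring

theorem aux_split (θ d u : ℝ) (hθ : 0 < θ) (hd : 0 < d) (hdu : d < u) (g : ℝ → ℝ)
    (hg : Continuous g) :
    ∫ x in Set.Ioi (0 : ℝ), g (min (max d x) u) * ((1 / θ) * Real.exp (-x / θ)) =
      g d * (1 - Real.exp (-d / θ)) + (∫ x in d..u, g x * ((1 / θ) * Real.exp (-x / θ)))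
        + g u * Real.exp (-u / θ) := by
  set F : ℝ → ℝ := fun x => g (min (max d x) u) * ((1 / θ) * Real.exp (-x / θ)) with hF
  have hFc : Continuous F := by
    rw [hF]; fun_prop
  have e3 : Set.EqOn F (fun x => g u * ((1 / θ) * Real.exp (-x / θ))) (Set.Ioi u) := by
    intro x hx
    have hx : u < x := hx
    simp only [hF]
    rw [max_eq_right (by linarith), min_eq_right hx.le]
  have i3 : IntegrableOn F (Set.Ioi u) :=
    (integrableOn_congr_fun e3 measurableSet_Ioi).2 ((aux_int_Ioi θ hθ u).1.const_mul _)
  have h3 : ∫ x in Set.Ioi u, F x = g u * Real.exp (-u / θ) := by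
    rw [setIntegral_congr_fun measurableSet_Ioi e3, integral_const_mul, (aux_int_Ioi θ hθ u).2]
  have hi : ∀ p q, IntervalIntegrable F volume p q := fun p q => hFc.intervalIntegrable p q
  have h1 : ∫ x in (0:ℝ)..d, F x = g d * (1 - Real.exp (-d / θ)) := by
    have : ∫ x in (0:ℝ)..d, F x = ∫ x in (0:ℝ)..d, g d * ((1 / θ) * Real.exp (-x / θ)) := by
      apply intervalIntegral.integral_congr
      intro x hx
      rw [Set.uIcc_of_le hd.le] at hx
      simp only [hF]
      rw [max_eq_left hx.2, min_eq_left hdu.le]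
    rw [this, intervalIntegral.integral_const_mul]
    congr 1
    rw [intervalIntegral.integral_eq_sub_of_hasDerivAt
      (f := fun x : ℝ => -Real.exp (-x / θ))]
    · simp; ring
    · intro x _
      refine HasDerivAt.congr_deriv (aux_deriv_exp θ hθ x).neg ?_; ring
    · apply Continuous.intervalIntegrable; fun_prop
  have h2 : ∫ x in d..u, F x = ∫ x in d..u, g x * ((1 / θ) * Real.exp (-x / θ)) := by
    apply intervalIntegral.integral_congr
    intro x hx
    rw [Set.uIcc_of_le hdu.le] at hx
    simp only [hF]
    rw [max_eq_right hx.1, min_eq_left hx.2]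
  have h0 : IntegrableOn F (Set.Ioi 0) := by
    rw [← Set.Ioc_union_Ioi_eq_Ioi (hd.trans hdu).le]
    refine IntegrableOn.union ?_ i3
    exact (intervalIntegrable_iff_integrableOn_Ioc_of_le (hd.trans hdu).le).1 (hi 0 u)
  have hs := intervalIntegral.integral_Ioi_sub_Ioi h0 (hd.trans hdu).le
  have ha := intervalIntegral.integral_add_adjacent_intervals (hi 0 d) (hi d u)
  rw [← h1, ← h2, ← h3, ha]
  linarith

theorem aux_log (A v : ℝ) (h : 1 - v ≠ 0) :
    HasDerivAt (fun v : ℝ => Real.log (1 - v)) (-(1 / (1 - v))) v := by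
  have := ((hasDerivAt_id v).const_sub 1).log h
  refine HasDerivAt.congr_deriv this ?_
  simp only [id_eq]; ring

theorem aux_I (a c : ℝ) (hac : a ≤ c) (hc : c < 1) :
    ∫ v in a..c, Real.log (1 - v) =
      (1 - a) * Real.log (1 - a) - (1 - c) * Real.log (1 - c) - (c - a) := by
  have hne : ∀ v ∈ Set.uIcc a c, 1 - v ≠ 0 := by
    intro v hv
    rw [Set.uIcc_of_le hac] at hv
    linarith [hv.2]
  rw [intervalIntegral.integral_eq_sub_of_hasDerivAt
    (f := fun v : ℝ => -((1 - v) * Real.log (1 - v)) - v)]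
  · ring
  · intro v hv
    have h := hne v hv
    have := ((((hasDerivAt_id v).const_sub 1).mul (aux_log 0 v h)).neg).sub (hasDerivAt_id v)
    refine HasDerivAt.congr_deriv this ?_
    simp only [id_eq]; field_simp; ring
  · apply ContinuousOn.intervalIntegrable
    exact ContinuousOn.log (by fun_prop) hne

theorem aux_inner (a c v : ℝ) (hav : a ≤ v) (hvc : v ≤ c) (hc : c < 1) :
    ∫ w in a..c, (min v w - v * w) / ((1 - v) * (1 - w)) =
      -Real.log (1 - v) + (Real.log (1 - a) + a + (1 - c)) - (1 - c) * (1 / (1 - v)) := by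
  have hv1 : 1 - v ≠ 0 := by linarith
  have hcont : ContinuousOn (fun w => (min v w - v * w) / ((1 - v) * (1 - w))) (Set.Iio 1) := by
    apply ContinuousOn.div (by fun_prop) (by fun_prop)
    intro w hw
    have : w < 1 := hw
    exact mul_ne_zero hv1 (by linarith)
  have i1 : IntervalIntegrable (fun w => (min v w - v * w) / ((1 - v) * (1 - w))) volume a v := by
    apply ContinuousOn.intervalIntegrable
    apply hcont.mono
    intro w hw
    rw [Set.uIcc_of_le hav] at hw
    exact lt_of_le_of_lt hw.2 (by linarith)
  have i2 : IntervalIntegrable (fun w => (min v w - v * w) / ((1 - v) * (1 - w))) volume v c := by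
    apply ContinuousOn.intervalIntegrable
    apply hcont.mono
    intro w hw
    rw [Set.uIcc_of_le hvc] at hw
    exact lt_of_le_of_lt hw.2 (by linarith)
  rw [← intervalIntegral.integral_add_adjacent_intervals i1 i2]
  have h2 : ∫ w in v..c, (min v w - v * w) / ((1 - v) * (1 - w)) = ∫ w in v..c, v / (1 - v) := by
    apply intervalIntegral.integral_congr
    intro w hw
    rw [Set.uIcc_of_le hvc] at hw
    have : 1 - w ≠ 0 := by linarith [hw.2]
    simp only
    rw [min_eq_left hw.1]
    field_simp
  rw [h2, intervalIntegral.integral_const, smul_eq_mul]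
  rw [intervalIntegral.integral_eq_sub_of_hasDerivAt
    (f := fun w : ℝ => -Real.log (1 - w) - w) _ i1]
  · field_simp; ring
  · intro w hw
    rw [Set.uIcc_of_le hav] at hw
    have h : 1 - w ≠ 0 := by linarith [hw.2]
    have := ((aux_log 0 w h).neg).sub (hasDerivAt_id w)
    refine HasDerivAt.congr_deriv this ?_
    rw [min_eq_right hw.2]
    field_simp; ring

theorem aux_J (a c : ℝ) (hac : a ≤ c) (hc : c < 1) :
    ∫ v in a..c, ∫ w in a..c, (min v w - v * w) / ((1 - v) * (1 - w)) =
      2 * (1 - c) * (Real.log (1 - c) - Real.log (1 - a)) + 2 * (c - a) - (c - a) ^ 2 := by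
  have hne : ∀ v ∈ Set.uIcc a c, 1 - v ≠ 0 := by
    intro v hv
    rw [Set.uIcc_of_le hac] at hv
    linarith [hv.2]
  have h1 : ∫ v in a..c, ∫ w in a..c, (min v w - v * w) / ((1 - v) * (1 - w)) =
      ∫ v in a..c, (-Real.log (1 - v) + (Real.log (1 - a) + a + (1 - c))
        - (1 - c) * (1 / (1 - v))) := by
    apply intervalIntegral.integral_congr
    intro v hv
    rw [Set.uIcc_of_le hac] at hv
    exact aux_inner a c v hv.1 hv.2 hc
  rw [h1, intervalIntegral.integral_eq_sub_of_hasDerivAt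
    (f := fun v : ℝ => ((1 - v) * Real.log (1 - v) + v) + v * (Real.log (1 - a) + a + (1 - c))
      + (1 - c) * Real.log (1 - v))]
  · ring
  · intro v hv
    have h := hne v hv
    have := (((((hasDerivAt_id v).const_sub 1).mul (aux_log 0 v h)).add (hasDerivAt_id v)).add
      ((hasDerivAt_id v).mul_const (Real.log (1 - a) + a + (1 - c)))).add
      ((aux_log 0 v h).const_mul (1 - c))
    refine HasDerivAt.congr_deriv this ?_
    simp only [id_eq]; field_simp; ring
  · apply ContinuousOn.intervalIntegrable
    have hl : ContinuousOn (fun v : ℝ => Real.log (1 - v)) (Set.uIcc a c) :=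
      ContinuousOn.log (by fun_prop) hne
    have hdv : ContinuousOn (fun v : ℝ => 1 / (1 - v)) (Set.uIcc a c) :=
      ContinuousOn.div (by fun_prop) (by fun_prop) hne
    exact (hl.neg.add continuousOn_const).sub (continuousOn_const.mul hdv)



/-- With d = −θ log(1−a), u = −θ log b (so F(d|θ)=a, 1−F(u|θ)=b for Exp(θ)),
and Z = min(max(d,X),u): σ²_MCM/θ² = J(a,1−b), and consequently
ARE_MCM = (pθ + d e^{-d/θ} − u e^{-u/θ})²/σ²_MCM = [I(a,1−b)]²/J(a,1−b),
the ARE of the method-of-trimmed-moments estimator. -/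
theorem stmt_16 (θ a b : ℝ) (hθ : 0 < θ) (ha : 0 < a) (hb : 0 < b) (hab : a + b < 1)
    (d u : ℝ) (hdef : d = -θ * Real.log (1 - a)) (hudef : u = -θ * Real.log b)
    (EZ EZ2 σ2 I J p : ℝ)
    (hEZ : EZ = ∫ x in Set.Ioi (0 : ℝ), (min (max d x) u) * ((1 / θ) * Real.exp (-x / θ)))
    (hEZ2 : EZ2 = ∫ x in Set.Ioi (0 : ℝ), (min (max d x) u) ^ 2 * ((1 / θ) * Real.exp (-x / θ)))
    (hσ2 : σ2 = EZ2 - EZ ^ 2)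
    (hI : I = ∫ v in a..(1 - b), Real.log (1 - v))
    (hJ : J = ∫ v in a..(1 - b), ∫ w in a..(1 - b), (min v w - v * w) / ((1 - v) * (1 - w)))
    (hp : p = Real.exp (-d / θ) - Real.exp (-u / θ)) :
    σ2 / θ ^ 2 = J ∧
    (p * θ + d * Real.exp (-d / θ) - u * Real.exp (-u / θ)) ^ 2 / σ2 = I ^ 2 / J := by


  have hA : 0 < 1 - a := by linarith
  have hd0 : 0 < d := by
    have := Real.log_neg hA (by linarith)
    rw [hdef]; nlinarith
  have hdu : d < u := by
    have := Real.log_lt_log hb (show b < 1 - a by linarith)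
    rw [hdef, hudef]; nlinarith
  have ed : Real.exp (-d / θ) = 1 - a := by
    rw [hdef, show -(-θ * Real.log (1 - a)) / θ = Real.log (1 - a) by field_simp,
      Real.exp_log hA]
  have eu : Real.exp (-u / θ) = b := by
    rw [hudef, show -(-θ * Real.log b) / θ = Real.log b by field_simp, Real.exp_log hb]
  have E1 : EZ = d + θ * ((1 - a) - b) := by
    rw [hEZ, aux_split θ d u hθ hd0 hdu (fun x => x) continuous_id,
      intervalIntegral.integral_eq_sub_of_hasDerivAt
        (f := fun x : ℝ => -((x + θ) * Real.exp (-x / θ)))]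
    · simp only [ed, eu]; ring
    · intro x _
      have := (((hasDerivAt_id x).add_const θ).mul (aux_deriv_exp θ hθ x)).neg
      refine HasDerivAt.congr_deriv this ?_
      simp only [id_eq]; field_simp; ring
    · apply Continuous.intervalIntegrable; fun_prop
  have E2 : EZ2 = d ^ 2 + 2 * θ * (d * (1 - a) - u * b) + 2 * θ ^ 2 * ((1 - a) - b) := by
    rw [hEZ2, aux_split θ d u hθ hd0 hdu (fun x => x ^ 2) (by fun_prop),
      intervalIntegral.integral_eq_sub_of_hasDerivAt
        (f := fun x : ℝ => -((x ^ 2 + (2 * θ * x + 2 * θ ^ 2)) * Real.exp (-x / θ)))]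
    · simp only [ed, eu]; ring
    · intro x _
      have := ((((hasDerivAt_id x).pow 2).add
        (((hasDerivAt_id x).const_mul (2 * θ)).add_const (2 * θ ^ 2))).mul
          (aux_deriv_exp θ hθ x)).neg
      refine HasDerivAt.congr_deriv this ?_
      simp; field_simp; ring
    · apply Continuous.intervalIntegrable; fun_prop
  have hI' := aux_I a (1 - b) (by linarith) (by linarith)
  have hJ' := aux_J a (1 - b) (by linarith) (by linarith)
  rw [← hI, sub_sub_cancel] at hI'
  rw [← hJ, sub_sub_cancel] at hJ'
  have hS : σ2 = θ ^ 2 * J := by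
    rw [hσ2, E1, E2, hJ', hdef, hudef]; ring
  have hN : p * θ + d * Real.exp (-d / θ) - u * Real.exp (-u / θ) = -(θ * I) := by
    rw [hp, ed, eu, hI', hdef, hudef]; ring
  have hθ2 : θ ^ 2 ≠ 0 := by positivity
  constructor
  · rw [hS, mul_div_cancel_left₀ _ hθ2]
  · rw [hN, hS, neg_sq, mul_pow, mul_div_mul_left _ _ hθ2]
end

section
/- Fix thresholds 0 ≤ d < u and a real number m. The equation φ(θ) = m, where φ(θ) := d + θ(1 − e^{-(u−d)/θ}) is the left-truncated right-censored mean E[X·1{d < X ≤ u} + u·1{X > u}] / (1 − F(d|θ)) for X ~ Exp(θ), has a solution θ ∈ (0, ∞) if and only if d < m < u, and in that case the solution is unique. -/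
open Real

theorem aux_mono_s19 (c a b : ℝ) (hc : 0 < c) (ha : 0 < a) (hab : a < b) :
    a * (1 - Real.exp (-c / a)) < b * (1 - Real.exp (-c / b)) := by
  have hb : 0 < b := ha.trans hab
  have hne : -c / a ≠ 0 := (div_neg_of_neg_of_pos (by linarith) ha).ne
  have h := strictConvexOn_exp.2 (Set.mem_univ (-c / a)) (Set.mem_univ (0:ℝ)) hne
    (div_pos ha hb) (sub_pos.2 ((div_lt_one hb).2 hab)) (by ring)
  simp only [smul_eq_mul, mul_zero, add_zero, Real.exp_zero, mul_one] at h
  have e : a / b * (-c / a) = -c / b := by field_simp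
  rw [e] at h
  have h2 := mul_lt_mul_of_pos_left h hb
  have e2 : b * (a / b * Real.exp (-c / a) + (1 - a / b)) = a * Real.exp (-c / a) + (b - a) := by
    field_simp
  rw [e2] at h2
  linarith

theorem aux_lower (c t : ℝ) (hc : 0 < c) (ht : 0 < t) :
    c * t / (t + c) ≤ t * (1 - Real.exp (-c / t)) := by
  have h1 : c / t + 1 ≤ Real.exp (c / t) := Real.add_one_le_exp _
  have hp : 0 < c / t + 1 := by positivity
  have h2 : Real.exp (-c / t) ≤ (c / t + 1)⁻¹ := by
    rw [neg_div, Real.exp_neg]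
    exact inv_anti₀ hp h1
  have e : c * t / (t + c) = t * (1 - (c / t + 1)⁻¹) := by
    have : c + t ≠ 0 := by positivity
    have : t + c ≠ 0 := by positivity
    field_simp
    ring
  rw [e]
  exact mul_le_mul_of_nonneg_left (by linarith) ht.le

/-- The MTCM estimating equation φ(θ) = m, φ(θ) = d + θ(1 − e^{-(u−d)/θ})
(the left-truncated right-censored mean of Exp(θ)), has a solution θ ∈ (0,∞)
iff d < m < u, and then the solution is unique. -/
theorem stmt_19 (d u m : ℝ) (hd : 0 ≤ d) (hdu : d < u)
    (φ : ℝ → ℝ)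
    (hφ : ∀ θ : ℝ, φ θ = d + θ * (1 - Real.exp (-(u - d) / θ))) :
    ((∃ θ : ℝ, 0 < θ ∧ φ θ = m) ↔ (d < m ∧ m < u)) ∧
    (d < m → m < u → ∃! θ : ℝ, 0 < θ ∧ φ θ = m) := by
  have hc : 0 < u - d := by linarith
  have key : d < m → m < u → ∃! θ : ℝ, 0 < θ ∧ φ θ = m := by
    intro h1 h2
    have hk : 0 < m - d := by linarith
    have hck : 0 < u - m := by linarith
    have hle : m - d ≤ (m - d) * (u - d) / (u - m) := by
      rw [le_div_iff₀ hck]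
      exact mul_le_mul_of_nonneg_left (by linarith) hk.le
    have hcont : ContinuousOn φ (Set.Icc (m - d) ((m - d) * (u - d) / (u - m))) := by
      have : φ = fun θ => d + θ * (1 - Real.exp (-(u - d) / θ)) := funext hφ
      rw [this]
      have hz : ∀ x ∈ Set.Icc (m - d) ((m - d) * (u - d) / (u - m)), x ≠ 0 :=
        fun x hx => (hk.trans_le hx.1).ne'
      exact continuousOn_const.add (continuousOn_id.mul (continuousOn_const.sub
        (Real.continuous_exp.comp_continuousOn (continuousOn_const.div continuousOn_id hz))))
    have hlo : φ (m - d) ≤ m := by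
      rw [hφ]
      have := mul_pos hk (Real.exp_pos (-(u - d) / (m - d)))
      linarith
    have hhi : m ≤ φ ((m - d) * (u - d) / (u - m)) := by
      rw [hφ]
      have h := aux_lower (u - d) _ hc (hk.trans_le hle)
      have e : (u - d) * ((m - d) * (u - d) / (u - m)) /
          ((m - d) * (u - d) / (u - m) + (u - d)) = m - d := by
        have e1 : (m - d) * (u - d) / (u - m) + (u - d) = (u - d) * (u - d) / (u - m) := by
          field_simp
          ring
        rw [e1]
        field_simp
      rw [e] at h
      linarith
    obtain ⟨θ, hθ, hm⟩ := intermediate_value_Icc hle hcont ⟨hlo, hhi⟩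
    have hθ0 : 0 < θ := hk.trans_le hθ.1
    refine ⟨θ, ⟨hθ0, hm⟩, ?_⟩
    rintro y ⟨hy, hym⟩
    rw [hφ] at hm hym
    rcases lt_trichotomy y θ with h | h | h
    · have := aux_mono_s19 _ _ _ hc hy h
      linarith
    · exact h
    · have := aux_mono_s19 _ _ _ hc hθ0 h
      linarith
  refine ⟨⟨?_, fun h => (key h.1 h.2).exists⟩, key⟩
  rintro ⟨θ, hθ, rfl⟩
  rw [hφ]
  have hneg : -(u - d) / θ < 0 := div_neg_of_neg_of_pos (by linarith) hθ
  constructor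
  · have := mul_pos hθ (sub_pos.2 (Real.exp_lt_one_iff.2 hneg))
    linarith
  · have h := mul_lt_mul_of_pos_left (Real.add_one_lt_exp hneg.ne) hθ
    have e : θ * (-(u - d) / θ + 1) = -(u - d) + θ := by field_simp
    rw [e] at h
    linarith
end
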